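/- Let M be a d × d real matrix with nonnegative entries acting on row vectors by x ↦ xM, and suppose every row of M has a nonzero entry (so the positive cone C is mapped into itself). Then c(M) < 1 if and only if for every pair of indices i, j with M_{ij} = 0, the entire j-th column of M is zero. -/

import Mathlib

/-- `aleph f g = sup {b ≥ 0 : b·f ≤ g pointwise}`. -/
noncomputable def aleph {X : Type*} (f g : X → ℝ) : ℝ :=
  sSup {b : ℝ | 0 ≤ b ∧ ∀ x, b * f x ≤ g x}

/-- `m(f,g) = ℵ(f,g)·ℵ(g,f)`. -/
noncomputable def mRatio {X : Type*} (f g : X → ℝ) : ℝ := aleph f g * aleph g f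

/-- The pseudo-Hilbert distance `d(f,g) = (1 − m(f,g))/(1 + m(f,g))`. -/
noncomputable def dProj {X : Type*} (f g : X → ℝ) : ℝ :=
  (1 - mRatio f g) / (1 + mRatio f g)

/-- Membership in the positive cone `C = {f ∈ E : f ≠ 0 and f(x) ≥ 0 for all x}`. -/
def InCone {X : Type*} (E : Submodule ℝ (X → ℝ)) (f : X → ℝ) : Prop :=
  f ∈ E ∧ f ≠ 0 ∧ ∀ x, 0 ≤ f x
open Matrix

/-- Membership in the positive cone `C = {x ∈ ℝᵈ : x ≠ 0 and xᵢ ≥ 0 for all i}`. -/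
def InConeFin {d : ℕ} (x : Fin d → ℝ) : Prop := x ≠ 0 ∧ ∀ i, 0 ≤ x i

/-- The row action `x ↦ xM` of a `d × d` matrix is `A`-uniformly positive. -/
def UnifPosMat {d : ℕ} (M : Matrix (Fin d) (Fin d) ℝ) (A : ℝ) : Prop :=
  ∃ h : Fin d → ℝ, InConeFin h ∧ ∀ x : Fin d → ℝ, InConeFin x →
    ∃ b : ℝ, 0 ≤ b ∧ ∀ j, A⁻¹ * b * h j ≤ (x ᵥ* M) j ∧ (x ᵥ* M) j ≤ A * b * h j

/-- The contraction coefficient `c(M) = sup {d(xM, yM) : x, y ∈ C}`. -/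
noncomputable def cMat {d : ℕ} (M : Matrix (Fin d) (Fin d) ℝ) : ℝ :=
  sSup {r : ℝ | ∃ x y : Fin d → ℝ, InConeFin x ∧ InConeFin y ∧
    r = dProj (x ᵥ* M) (y ᵥ* M)}

theorem aleph_nonneg {X : Type*} (f g : X → ℝ) : 0 ≤ aleph f g :=
  Real.sSup_nonneg fun _ hb => hb.1

theorem mRatio_nonneg {X : Type*} (f g : X → ℝ) : 0 ≤ mRatio f g :=
  mul_nonneg (aleph_nonneg f g) (aleph_nonneg g f)

theorem le_aleph {X : Type*} {f g : X → ℝ} {b : ℝ} {x : X} (hx : 0 < f x) (hb : 0 ≤ b)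
    (h : ∀ x, b * f x ≤ g x) : b ≤ aleph f g :=
  le_csSup ⟨g x / f x, fun _ hc => (le_div_iff₀ hx).2 (hc.2 x)⟩ ⟨hb, h⟩

theorem aleph_eq_zero {X : Type*} {f g : X → ℝ} {x : X} (hf : 0 < f x) (hg : g x = 0) :
    aleph f g = 0 := by
  refine le_antisymm (Real.sSup_nonpos fun b hb => ?_) (aleph_nonneg f g)
  have h := hb.2 x
  rw [hg] at h
  exact nonpos_of_mul_nonpos_left h hf

theorem dProj_le_of_le_mRatio {X : Type*} {f g : X → ℝ} {δ : ℝ} (hδ : 0 ≤ δ)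
    (h : δ ≤ mRatio f g) : dProj f g ≤ (1 - δ) / (1 + δ) := by
  have hm := mRatio_nonneg f g
  rw [dProj, div_le_div_iff₀ (by linarith) (by linarith)]
  nlinarith

theorem InConeFin.sum_pos {d : ℕ} {x : Fin d → ℝ} (hx : InConeFin x) : 0 < ∑ i, x i := by
  obtain ⟨i, hi⟩ := Function.ne_iff.1 hx.1
  exact Finset.sum_pos' (fun i _ => hx.2 i) ⟨i, Finset.mem_univ i, (hx.2 i).lt_of_ne' hi⟩

theorem inConeFin_single {d : ℕ} (i : Fin d) : InConeFin (Pi.single i (1 : ℝ)) :=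
  ⟨by simp, fun j => (Pi.single_nonneg.2 zero_le_one : (0 : Fin d → ℝ) ≤ Pi.single i 1) j⟩

theorem exists_vecMul_pos {d : ℕ} {M : Matrix (Fin d) (Fin d) ℝ} (hM : ∀ i j, 0 ≤ M i j)
    (hrow : ∀ i, ∃ j, M i j ≠ 0) {x : Fin d → ℝ} (hx : InConeFin x) :
    ∃ j, 0 < (x ᵥ* M) j := by
  obtain ⟨i, hi⟩ := Function.ne_iff.1 hx.1
  obtain ⟨j, hj⟩ := hrow i
  exact ⟨j, Finset.sum_pos' (fun k _ => mul_nonneg (hx.2 k) (hM k j))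
    ⟨i, Finset.mem_univ i, mul_pos ((hx.2 i).lt_of_ne' hi) ((hM i j).lt_of_ne' hj)⟩⟩

/-- If the entries of each column of `M` are comparable up to a factor `ε`, so are the images
under `M` of any two vectors of the cone, after normalising their masses. -/
theorem mul_vecMul_le {d : ℕ} {M : Matrix (Fin d) (Fin d) ℝ} {ε : ℝ}
    (hε : ∀ i k j, ε * M k j ≤ M i j) {x y : Fin d → ℝ} (hx : InConeFin x) (hy : InConeFin y)
    (j : Fin d) : ε * (∑ k, y k) / (∑ k, x k) * (x ᵥ* M) j ≤ (y ᵥ* M) j := by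
  rw [div_mul_eq_mul_div, div_le_iff₀ hx.sum_pos]
  simp only [vecMul, dotProduct, Finset.mul_sum, Finset.sum_mul]
  refine Finset.sum_le_sum fun k _ => Finset.sum_le_sum fun i _ => ?_
  have := mul_le_mul_of_nonneg_left (hε i k j) (mul_nonneg (hx.2 k) (hy.2 i))
  linarith

theorem sq_le_mRatio_vecMul {d : ℕ} {M : Matrix (Fin d) (Fin d) ℝ} (hM : ∀ i j, 0 ≤ M i j)
    (hrow : ∀ i, ∃ j, M i j ≠ 0) {ε : ℝ} (hε₀ : 0 ≤ ε) (hε : ∀ i k j, ε * M k j ≤ M i j)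
    {x y : Fin d → ℝ} (hx : InConeFin x) (hy : InConeFin y) :
    ε ^ 2 ≤ mRatio (x ᵥ* M) (y ᵥ* M) := by
  have key : ∀ {u v : Fin d → ℝ}, InConeFin u → InConeFin v →
      ε * (∑ k, v k) / (∑ k, u k) ≤ aleph (u ᵥ* M) (v ᵥ* M) := fun hu hv =>
    (exists_vecMul_pos hM hrow hu).elim fun _ hj => le_aleph hj
      (div_nonneg (mul_nonneg hε₀ hv.sum_pos.le) hu.sum_pos.le) (mul_vecMul_le hε hu hv)
  have hsx := hx.sum_pos
  have hsy := hy.sum_pos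
  calc ε ^ 2 = ε * (∑ k, y k) / (∑ k, x k) * (ε * (∑ k, x k) / (∑ k, y k)) := by
        field_simp
    _ ≤ mRatio (x ᵥ* M) (y ᵥ* M) :=
        mul_le_mul (key hx hy) (key hy hx) (by positivity) (aleph_nonneg _ _)

open Filter Topology in
theorem exists_column_comparison {d : ℕ} {M : Matrix (Fin d) (Fin d) ℝ}
    (hM : ∀ i j, 0 ≤ M i j) (h : ∀ i j, M i j = 0 → ∀ k, M k j = 0) :
    ∃ ε : ℝ, 0 < ε ∧ ε < 1 ∧ ∀ i k j, ε * M k j ≤ M i j := by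
  have key : ∀ᶠ ε : ℝ in 𝓝[>] 0, ∀ i k j, ε * M k j ≤ M i j := by
    simp only [eventually_all]
    intro i k j
    by_cases hij : M i j = 0
    · simp [hij, h i j hij k]
    · have ht : Tendsto (fun ε : ℝ => ε * M k j) (𝓝[>] 0) (𝓝 0) :=
        ((continuous_id.mul continuous_const).tendsto' _ _ (by simp)).mono_left
          nhdsWithin_le_nhds
      exact (ht.eventually_lt_const ((hM i j).lt_of_ne' hij)).mono fun _ => le_of_lt
  obtain ⟨ε, hε, h01⟩ := (key.and (Ioo_mem_nhdsGT zero_lt_one)).exists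
  exact ⟨ε, h01.1, h01.2, hε⟩

theorem stmt_17 {d : ℕ} (M : Matrix (Fin d) (Fin d) ℝ)
    (hM : ∀ i j, 0 ≤ M i j) (hrow : ∀ i, ∃ j, M i j ≠ 0) :
    cMat M < 1 ↔ ∀ i j, M i j = 0 → ∀ k, M k j = 0 := by
  constructor
  · intro hc i j hij k
    by_contra hkj
    refine hc.not_ge (le_csSup ⟨1, ?_⟩
      ⟨Pi.single i 1, Pi.single k 1, inConeFin_single i, inConeFin_single k, ?_⟩)
    · rintro _ ⟨x, y, -, -, rfl⟩
      simpa using dProj_le_of_le_mRatio le_rfl (mRatio_nonneg (x ᵥ* M) (y ᵥ* M))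
    · have h0 : aleph (Pi.single k 1 ᵥ* M) (Pi.single i 1 ᵥ* M) = 0 :=
        aleph_eq_zero (x := j) (by simpa using (hM k j).lt_of_ne' hkj) (by simpa using hij)
      rw [dProj, mRatio, h0]
      simp
  · intro h
    obtain ⟨ε, hε₀, hε₁, hε⟩ := exists_column_comparison hM h
    have hsq : ε ^ 2 < 1 := by nlinarith
    have hpos : 0 < ε ^ 2 := by positivity
    refine lt_of_le_of_lt (b := (1 - ε ^ 2) / (1 + ε ^ 2)) (Real.sSup_le ?_ ?_) ?_
    · rintro _ ⟨x, y, hx, hy, rfl⟩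
      exact dProj_le_of_le_mRatio hpos.le (sq_le_mRatio_vecMul hM hrow hε₀.le hε hx hy)
    · exact div_nonneg (by linarith) (by linarith)
    · rw [div_lt_one (by linarith)]
      linarith
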